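/- 3F2(1/2, 1/2, 1/2; 1, 1; 1) = (2/√3) · 3F2(1/2, 1/6, 5/6; 1, 1; 1). -/

import Mathlib

open Real

/-- Ascending Pochhammer symbol `(x)_k = x(x+1)⋯(x+k−1)`. -/
noncomputable def poch (x : ℝ) (k : ℕ) : ℝ := (ascPochhammer ℝ k).eval x

/-- The Beta function quotient `B(x,y) = Γ(x)Γ(y)/Γ(x+y)`. -/
noncomputable def betaR (x y : ℝ) : ℝ := Gamma x * Gamma y / Gamma (x + y)

/-- Generalized hypergeometric series `₃F₂(a₁,a₂,a₃; b₁,b₂; z)`. -/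
noncomputable def F32 (a1 a2 a3 b1 b2 z : ℝ) : ℝ :=
  ∑' k : ℕ, (poch a1 k * poch a2 k * poch a3 k)
      / (poch b1 k * poch b2 k * (k.factorial : ℝ)) * z ^ k

/-- The hypergeometric period value `P(r,s) = π · B(r, s−r) · ₃F₂(1/2,1/2,r; 1,s; 1)`. -/
noncomputable def P (r s : ℝ) : ℝ := π * betaR r (s - r) * F32 (1/2) (1/2) r 1 s 1

open Filter Topology Finset

theorem poch_zero (x : ℝ) : poch x 0 = 1 := by simp [poch]

theorem poch_succ (x : ℝ) (k : ℕ) : poch x (k + 1) = poch x k * (x + k) := by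
  simp [poch, ascPochhammer_succ_eval]

theorem poch_one (k : ℕ) : poch 1 k = (k.factorial : ℝ) := by
  simp [poch]

theorem poch_pos {x : ℝ} (hx : 0 < x) (k : ℕ) : 0 < poch x k :=
  ascPochhammer_pos k x hx

theorem poch_eq_prod (x : ℝ) (k : ℕ) : poch x k = ∏ j ∈ range k, (x + j) := by
  induction k with
  | zero => simp [poch_zero]
  | succ k ih => rw [poch_succ, ih, prod_range_succ]

theorem mul_poch_add_one (x : ℝ) (k : ℕ) : x * poch (x + 1) k = poch x k * (x + k) := by
  induction k with
  | zero => simp [poch_zero]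
  | succ k ih => rw [poch_succ, ← mul_assoc, ih, poch_succ]; push_cast; ring

/-- The `k`-th term of the Gauss series `₂F₁(a, b; n + 1; 1)`. -/
noncomputable def gaussTerm (a b : ℝ) (n k : ℕ) : ℝ :=
  poch a k * poch b k / (poch (n + 1) k * k.factorial)

theorem gaussTerm_zero_right (a b : ℝ) (n : ℕ) : gaussTerm a b n 0 = 1 := by
  simp [gaussTerm, poch_zero]

theorem gaussTerm_nonneg {a b : ℝ} (ha : 0 < a) (hb : 0 < b) (n k : ℕ) :
    0 ≤ gaussTerm a b n k := by
  have h1 := poch_pos ha k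
  have h2 := poch_pos hb k
  have h3 := poch_pos (x := (n : ℝ) + 1) (by positivity) k
  unfold gaussTerm
  positivity

theorem gaussTerm_succ_right (a b : ℝ) (n k : ℕ) :
    (n + 1 + k) * (k + 1) * gaussTerm a b n (k + 1) = (a + k) * (b + k) * gaussTerm a b n k := by
  have h3 := (poch_pos (x := (n : ℝ) + 1) (by positivity) k).ne'
  have h4 : (n : ℝ) + 1 + k ≠ 0 := by positivity
  have h5 : (k.factorial : ℝ) ≠ 0 := by positivity
  simp only [gaussTerm, poch_succ, Nat.factorial_succ]
  push_cast
  field_simp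

theorem gaussTerm_succ_left (a b : ℝ) (n k : ℕ) :
    (n + 1 + k) * gaussTerm a b (n + 1) k = (n + 1) * gaussTerm a b n k := by
  have h3 := (poch_pos (x := (n : ℝ) + 1) (by positivity) k).ne'
  have h4 := (poch_pos (x := (n : ℝ) + 1 + 1) (by positivity) k).ne'
  have h5 : (k.factorial : ℝ) ≠ 0 := by positivity
  have h := mul_poch_add_one ((n : ℝ) + 1) k
  simp only [gaussTerm]
  push_cast
  field_simp
  linear_combination -(poch a k * poch b k) * h

/-! ### Clausen's formula -/

section Clausen

open PowerSeries

theorem coeff_X_mul_derivative (f : ℝ⟦X⟧) (n : ℕ) :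
    coeff n (X * d⁄dX ℝ f) = n * coeff n f := by
  cases n with
  | zero => simp
  | succ n => rw [coeff_succ_X_mul, coeff_derivative]; push_cast; ring

theorem gaussTerm_sq_recurrence {a b : ℝ} (hab : a + b = 1 / 2) (n : ℕ) :
    ((n : ℝ) + 1) ^ 3 * coeff (n + 1) (PowerSeries.mk (gaussTerm a b 0) ^ 2) =
      (1 / 2 + n) * (2 * a + n) * (2 * b + n) *
        coeff n (PowerSeries.mk (gaussTerm a b 0) ^ 2) := by
  set y : ℝ⟦X⟧ := PowerSeries.mk (gaussTerm a b 0) with hy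
  obtain ⟨θ, θ_def⟩ : ∃ θ : ℝ⟦X⟧ → ℝ⟦X⟧, ∀ f, θ f = X * d⁄dX ℝ f := ⟨_, fun _ => rfl⟩
  have hθ (f n) : coeff n (θ f) = n * coeff n f := by
    rw [θ_def, coeff_X_mul_derivative]
  have hadd (f g) : θ (f + g) = θ f + θ g := by simp only [θ_def, map_add]; ring
  have hmul (f g) : θ (f * g) = θ f * g + f * θ g := by
    simp only [θ_def, Derivation.leibniz, smul_eq_mul]; ring
  have hC (r : ℝ) : θ (C r) = 0 := by simp [θ_def]
  have hX : θ X = X := by simp [θ_def]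
  have E : θ (θ y) = X * (θ (θ y) + C (1 / 2) * θ y + C (a * b) * y) := by
    ext m
    cases m with
    | zero => simp [hθ]
    | succ m =>
      rw [coeff_succ_X_mul]
      simp only [hθ, map_add, coeff_C_mul, hy, coeff_mk]
      have := gaussTerm_succ_right a b 0 m
      push_cast at this ⊢
      linear_combination this + (m : ℝ) * gaussTerm a b 0 m * hab
  have E' := congrArg θ E
  simp only [hmul, hadd, hC, hX] at E'
  have h2 : (C (1 / 2) : ℝ⟦X⟧) * 2 = 1 := by
    rw [← map_ofNat (C : ℝ →+* ℝ⟦X⟧) 2, ← map_mul]; norm_num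
  have key : θ (θ (θ (y ^ 2))) = X * (θ (θ (θ (y ^ 2))) + C (3 / 2) * θ (θ (y ^ 2))
      + C (1 / 2 + 4 * (a * b)) * θ (y ^ 2) + C (2 * (a * b)) * y ^ 2) := by
    have h3 : (C (3 / 2) : ℝ⟦X⟧) = 3 * C (1 / 2) := by
      rw [← map_ofNat (C : ℝ →+* ℝ⟦X⟧) 3, ← map_mul]; norm_num
    have h4 : (C (4 * (a * b)) : ℝ⟦X⟧) = 4 * C (a * b) := by
      rw [← map_ofNat (C : ℝ →+* ℝ⟦X⟧) 4, ← map_mul]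
    have h5 : (C (2 * (a * b)) : ℝ⟦X⟧) = 2 * C (a * b) := by
      rw [← map_ofNat (C : ℝ →+* ℝ⟦X⟧) 2, ← map_mul]
    rw [map_add, h3, h4, h5, pow_two]
    simp only [hmul, hadd]
    linear_combination 6 * θ y * E + 2 * y * E' - 2 * X * y * θ (θ y) * h2
  have := congrArg (coeff (n + 1)) key
  rw [coeff_succ_X_mul] at this
  simp only [hθ, map_add, add_mul, coeff_C_mul] at this
  push_cast at this
  have hb : b = 1 / 2 - a := by linarith
  subst hb
  linear_combination this

theorem sum_antidiagonal_gaussTerm {a b : ℝ} (hab : a + b = 1 / 2) (n : ℕ) :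
    ∑ ij ∈ antidiagonal n, gaussTerm a b 0 ij.1 * gaussTerm a b 0 ij.2 =
      poch (1 / 2) n * poch (2 * a) n * poch (2 * b) n /
        (poch 1 n * poch 1 n * (n.factorial : ℝ)) := by
  have h : ∀ n, coeff n (PowerSeries.mk (gaussTerm a b 0) ^ 2) =
      ∑ ij ∈ antidiagonal n, gaussTerm a b 0 ij.1 * gaussTerm a b 0 ij.2 := by
    intro n; simp [pow_two, PowerSeries.coeff_mul]
  rw [← h]
  induction n with
  | zero => simp [h, gaussTerm_zero_right, poch_zero]
  | succ n ih =>
    have hrec := gaussTerm_sq_recurrence hab n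
    rw [ih] at hrec
    have h1 : ((n : ℝ) + 1) ^ 3 ≠ 0 := by positivity
    apply mul_left_cancel₀ h1
    rw [hrec]
    simp only [poch_succ, poch_one, Nat.factorial_succ]
    have h5 : (n.factorial : ℝ) ≠ 0 := by positivity
    push_cast
    field_simp
    ring

end Clausen

/-! ### Gauss's summation theorem -/

theorem gaussTerm_zero_sq_le {a b : ℝ} (ha : 0 < a) (hb : 0 < b) (hab : a + b = 1 / 2) (k : ℕ) :
    gaussTerm a b 0 k ^ 2 ≤ 1 / ((k : ℝ) + 1) ^ 3 := by
  induction k with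
  | zero => simp [gaussTerm_zero_right]
  | succ k ih =>
    have hrec := gaussTerm_succ_right a b 0 k
    have hk : (0 : ℝ) ≤ k := k.cast_nonneg
    have e : gaussTerm a b 0 (k + 1) = (a + k) * (b + k) * gaussTerm a b 0 k / ((k : ℝ) + 1) ^ 2 := by
      field_simp
      push_cast at hrec
      linear_combination hrec
    have hq : (a + k) * (b + k) ≤ ((k : ℝ) + 1 / 4) ^ 2 := by
      have : b = 1 / 2 - a := by linarith
      subst this
      nlinarith [sq_nonneg (a - 1 / 4)]
    have hp : 0 ≤ (a + k) * (b + k) := by positivity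
    rw [e, div_pow, mul_pow]
    calc ((a + k) * (b + k)) ^ 2 * gaussTerm a b 0 k ^ 2 / (((k : ℝ) + 1) ^ 2) ^ 2
        ≤ (((k : ℝ) + 1 / 4) ^ 2) ^ 2 * (1 / ((k : ℝ) + 1) ^ 3) / (((k : ℝ) + 1) ^ 2) ^ 2 := by
          gcongr
      _ ≤ _ := by
          push_cast
          rw [← sub_nonneg]
          have : 1 / ((k : ℝ) + 1 + 1) ^ 3 -
              (((k : ℝ) + 1 / 4) ^ 2) ^ 2 * (1 / ((k : ℝ) + 1) ^ 3) / (((k : ℝ) + 1) ^ 2) ^ 2 =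
              (((k : ℝ) + 1) ^ 7 - ((k : ℝ) + 1 / 4) ^ 4 * ((k : ℝ) + 2) ^ 3) /
                (((k : ℝ) + 2) ^ 3 * ((k : ℝ) + 1) ^ 7) := by
            rw [show (k : ℝ) + 1 + 1 = k + 2 by ring]
            field_simp
          rw [this]
          apply div_nonneg _ (by positivity)
          ring_nf
          positivity

theorem summable_gaussTerm_zero {a b : ℝ} (ha : 0 < a) (hb : 0 < b) (hab : a + b = 1 / 2) :
    Summable (gaussTerm a b 0) := by
  have hs : Summable fun k : ℕ => 1 / ((k + 1 : ℕ) : ℝ) ^ (3 / 2 : ℝ) :=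
    (summable_nat_add_iff 1).2 (Real.summable_one_div_nat_rpow.2 (by norm_num))
  refine hs.of_nonneg_of_le (gaussTerm_nonneg ha hb 0) fun k => ?_
  refine le_of_sq_le_sq ?_ (by positivity)
  refine (gaussTerm_zero_sq_le ha hb hab k).trans_eq ?_
  rw [div_pow, ← Real.rpow_natCast (_ ^ (3 / 2 : ℝ)), ← Real.rpow_mul (by positivity),
    ← Real.rpow_natCast _ 3]
  norm_num

theorem gaussTerm_succ_le {a b : ℝ} (ha : 0 < a) (hb : 0 < b) (n k : ℕ) :
    gaussTerm a b (n + 1) k ≤ gaussTerm a b n k := by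
  have h := gaussTerm_succ_left a b n k
  have h0 := gaussTerm_nonneg ha hb (n + 1) k
  have hn : (0 : ℝ) < n + 1 := by positivity
  have hk : (0 : ℝ) ≤ k := k.cast_nonneg
  refine le_of_mul_le_mul_left ?_ hn
  rw [← h]
  nlinarith [mul_nonneg hk h0]

theorem gaussTerm_le_zero {a b : ℝ} (ha : 0 < a) (hb : 0 < b) (n k : ℕ) :
    gaussTerm a b n k ≤ gaussTerm a b 0 k :=
  antitone_nat_of_succ_le (f := fun n => gaussTerm a b n k)
    (fun n => gaussTerm_succ_le ha hb n k) n.zero_le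

theorem summable_gaussTerm {a b : ℝ} (ha : 0 < a) (hb : 0 < b) (hab : a + b = 1 / 2) (n : ℕ) :
    Summable (gaussTerm a b n) :=
  (summable_gaussTerm_zero ha hb hab).of_nonneg_of_le (gaussTerm_nonneg ha hb n)
    (gaussTerm_le_zero ha hb n)

theorem tendsto_mul_gaussTerm {a b : ℝ} (ha : 0 < a) (hb : 0 < b) (hab : a + b = 1 / 2) (n : ℕ) :
    Tendsto (fun k : ℕ => (k : ℝ) * gaussTerm a b n k) atTop (𝓝 0) := by
  have h0 : Tendsto (fun k : ℕ => ((k : ℝ) * gaussTerm a b n k) ^ 2) atTop (𝓝 0) := by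
    refine squeeze_zero (fun k => by positivity) (fun k => ?_)
      tendsto_one_div_add_atTop_nhds_zero_nat
    calc ((k : ℝ) * gaussTerm a b n k) ^ 2
        ≤ ((k : ℝ) + 1) ^ 2 * (1 / ((k : ℝ) + 1) ^ 3) := by
          rw [mul_pow]
          have h1 := gaussTerm_nonneg ha hb n k
          gcongr
          · linarith
          · exact (pow_le_pow_left₀ h1 (gaussTerm_le_zero ha hb n k) 2).trans
              (gaussTerm_zero_sq_le ha hb hab k)
      _ = 1 / ((k : ℝ) + 1) := by field_simp
  have := (Real.continuous_sqrt.tendsto 0).comp h0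
  rw [Real.sqrt_zero] at this
  refine this.congr fun k => ?_
  exact Real.sqrt_sq (mul_nonneg k.cast_nonneg (gaussTerm_nonneg ha hb n k))

theorem tsum_gaussTerm_succ {a b : ℝ} (ha : 0 < a) (hb : 0 < b) (hab : a + b = 1 / 2) (n : ℕ) :
    ((n : ℝ) + 1) * (n + 1 / 2) * ∑' k, gaussTerm a b n k =
      (n + 1 - a) * (n + 1 - b) * ∑' k, gaussTerm a b (n + 1) k := by
  have h1 := (summable_gaussTerm ha hb hab n).hasSum.mul_left (((n : ℝ) + 1) * (n + 1 / 2))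
  have h2 := (summable_gaussTerm ha hb hab (n + 1)).hasSum.mul_left
    (((n : ℝ) + 1 - a) * (n + 1 - b))
  have h3 := (h1.sub h2).tendsto_sum_nat
  have h4 : Tendsto (fun N : ℕ => -((n : ℝ) + 1) * ((N : ℝ) * gaussTerm a b n N)) atTop (𝓝 0) := by
    simpa using (tendsto_mul_gaussTerm ha hb hab n).const_mul (-((n : ℝ) + 1))
  refine sub_eq_zero.1 (tendsto_nhds_unique h3 (h4.congr fun N => ?_))
  have := Finset.sum_range_sub (fun k : ℕ => -((n : ℝ) + 1) * ((k : ℝ) * gaussTerm a b n k)) N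
  simp only [Nat.cast_zero, zero_mul, mul_zero, sub_zero] at this
  rw [← this]
  refine Finset.sum_congr rfl fun k _ => ?_
  have e1 := gaussTerm_succ_right a b n k
  have e2 := gaussTerm_succ_left a b n k
  have hne : (n : ℝ) + 1 + k ≠ 0 := by positivity
  have hb : b = 1 / 2 - a := by linarith
  subst hb
  apply mul_left_cancel₀ hne
  push_cast
  linear_combination (-(n : ℝ) - 1) * e1 + ((n : ℝ) + 1 - a) * (n + 1 - (1 / 2 - a)) * e2

theorem tendsto_tsum_gaussTerm {a b : ℝ} (ha : 0 < a) (hb : 0 < b) (hab : a + b = 1 / 2) :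
    Tendsto (fun n => ∑' k, gaussTerm a b n k) atTop (𝓝 1) := by
  have h : Tendsto (fun n => ∑' k, gaussTerm a b n k) atTop
      (𝓝 (∑' k : ℕ, if k = 0 then (1 : ℝ) else 0)) := by
    refine tendsto_tsum_of_dominated_convergence (summable_gaussTerm_zero ha hb hab) ?_ ?_
    · intro k
      rcases Nat.eq_zero_or_pos k with rfl | hk
      · simp [gaussTerm_zero_right]
      · rw [if_neg hk.ne']
        have hlim : Tendsto (fun n : ℕ => gaussTerm a b 0 k * (1 / ((n : ℝ) + 1))) atTop (𝓝 0) := by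
          simpa using tendsto_one_div_add_atTop_nhds_zero_nat.const_mul (gaussTerm a b 0 k)
        refine squeeze_zero (fun n => gaussTerm_nonneg ha hb n k) (fun n => ?_) hlim
        induction n with
        | zero => simp
        | succ n ih =>
          have e := gaussTerm_succ_left a b n k
          have h1 := gaussTerm_nonneg ha hb (n + 1) k
          have hk1 : (1 : ℝ) ≤ k := by exact_mod_cast hk
          rw [mul_one_div, le_div_iff₀ (by positivity)] at ih ⊢
          push_cast
          nlinarith [mul_nonneg (sub_nonneg.2 hk1) h1]
    · exact Eventually.of_forall fun n k => by
        rw [Real.norm_of_nonneg (gaussTerm_nonneg ha hb n k)]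
        exact gaussTerm_le_zero ha hb n k
  simpa using h

theorem tsum_gaussTerm_zero_mul {a b : ℝ} (ha : 0 < a) (hb : 0 < b) (hab : a + b = 1 / 2)
    (N : ℕ) :
    poch 1 N * poch (1 / 2) N * ∑' k, gaussTerm a b 0 k =
      poch (1 - a) N * poch (1 - b) N * ∑' k, gaussTerm a b N k := by
  induction N with
  | zero => simp [poch_zero]
  | succ N ih =>
    have e := tsum_gaussTerm_succ ha hb hab N
    simp only [poch_succ]
    linear_combination ((N : ℝ) + 1) * (N + 1 / 2) * ih + poch (1 - a) N * poch (1 - b) N * e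

theorem gammaSeq_eq (s : ℝ) (n : ℕ) :
    GammaSeq s n = (n : ℝ) ^ s * n.factorial / poch s (n + 1) := by
  rw [GammaSeq, poch_eq_prod]

/-- Gauss's evaluation of `₂F₁(a, b; 1; 1)` for `a + b = 1 / 2`. -/
theorem tsum_gaussTerm_zero {a b : ℝ} (ha : 0 < a) (hb : 0 < b) (hab : a + b = 1 / 2) :
    ∑' k, gaussTerm a b 0 k = √π / (Gamma (1 - a) * Gamma (1 - b)) := by
  have hΓa : Gamma (1 - a) ≠ 0 := (Gamma_pos_of_pos (by linarith)).ne'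
  have hΓb : Gamma (1 - b) ≠ 0 := (Gamma_pos_of_pos (by linarith)).ne'
  have h1 := (((GammaSeq_tendsto_Gamma 1).mul (GammaSeq_tendsto_Gamma (1 / 2))).mul
    ((tendsto_tsum_gaussTerm ha hb hab).comp (tendsto_add_atTop_nat 1))).div
    ((GammaSeq_tendsto_Gamma (1 - a)).mul (GammaSeq_tendsto_Gamma (1 - b))) (mul_ne_zero hΓa hΓb)
  rw [Gamma_one, Gamma_one_half_eq, one_mul, mul_one] at h1
  refine tendsto_nhds_unique (tendsto_const_nhds.congr' ?_) h1
  filter_upwards [eventually_gt_atTop 0] with n hn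
  have e := tsum_gaussTerm_zero_mul ha hb hab (n + 1)
  have hn' : (0 : ℝ) < n := by exact_mod_cast hn
  have p1 := (poch_pos (x := 1) (by norm_num) (n + 1)).ne'
  have p2 := (poch_pos (x := 1 / 2) (by norm_num) (n + 1)).ne'
  have p3 := (poch_pos (x := 1 - a) (by linarith) (n + 1)).ne'
  have p4 := (poch_pos (x := 1 - b) (by linarith) (n + 1)).ne'
  have hf : (n.factorial : ℝ) ≠ 0 := by positivity
  have q : (n : ℝ) ^ (1 : ℝ) * (n : ℝ) ^ (1 / 2 : ℝ) = (n : ℝ) ^ (1 - a) * (n : ℝ) ^ (1 - b) := by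
    rw [← Real.rpow_add hn', ← Real.rpow_add hn']
    congr 1
    linarith
  have q3 : (n : ℝ) ^ (1 - a) ≠ 0 := by positivity
  have q4 : (n : ℝ) ^ (1 - b) ≠ 0 := by positivity
  simp only [Pi.div_apply, Function.comp_apply, gammaSeq_eq]
  rw [eq_div_iff (by positivity)]
  generalize (n : ℝ) ^ (1 - a) = u at *
  generalize (n : ℝ) ^ (1 - b) = v at *
  generalize (n : ℝ) ^ (1 : ℝ) = r at *
  generalize (n : ℝ) ^ (1 / 2 : ℝ) = s at *
  generalize ∑' k, gaussTerm a b 0 k = S at *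
  generalize ∑' k, gaussTerm a b (n + 1) k = S' at *
  field_simp
  linear_combination u * v * e - poch (1 - a) (n + 1) * poch (1 - b) (n + 1) * S' * q

/-! ### A case of the triplication formula for the Gamma function -/

theorem poch_three_mul (s : ℝ) (n : ℕ) :
    poch (3 * s) (3 * n) = 27 ^ n * (poch s n * poch (s + 1 / 3) n * poch (s + 2 / 3) n) := by
  induction n with
  | zero => simp [poch_zero]
  | succ n ih =>
    rw [show 3 * (n + 1) = 3 * n + 1 + 1 + 1 by ring]
    simp only [poch_succ, ih]
    push_cast
    ring

/-- Up to the power of `3`, the ratio in the triplication formula does not depend on `s`. -/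
theorem tendsto_triplication {s : ℝ} (hs : 0 < s) :
    Tendsto (fun n : ℕ => (n : ℝ) * (n.factorial : ℝ) ^ 3 * 27 ^ (n + 1) / (3 * n + 2).factorial)
      atTop (𝓝 (3 ^ (3 * s) * (Gamma s * Gamma (s + 1 / 3) * Gamma (s + 2 / 3)) /
        Gamma (3 * s))) := by
  have hΓ : Gamma (3 * s) ≠ 0 := (Gamma_pos_of_pos (by linarith)).ne'
  have hsub : Tendsto (fun n : ℕ => 3 * n + 2) atTop atTop :=
    tendsto_atTop_mono (fun n => by simp only [id]; omega) tendsto_id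
  have hr : Tendsto (fun n : ℕ => 3 + 2 / (n : ℝ)) atTop (𝓝 3) := by
    simpa using (tendsto_const_div_atTop_nhds_zero_nat (2 : ℝ)).const_add 3
  have hr' := hr.rpow_const (p := 3 * s) (Or.inl (by norm_num))
  have h := (hr'.mul (((GammaSeq_tendsto_Gamma s).mul (GammaSeq_tendsto_Gamma (s + 1 / 3))).mul
    (GammaSeq_tendsto_Gamma (s + 2 / 3)))).div ((GammaSeq_tendsto_Gamma (3 * s)).comp hsub) hΓ
  refine h.congr' ?_
  filter_upwards [eventually_gt_atTop 0] with n hn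
  have hn' : (0 : ℝ) < n := by exact_mod_cast hn
  have p1 := (poch_pos hs (n + 1)).ne'
  have p2 := (poch_pos (x := s + 1 / 3) (by linarith) (n + 1)).ne'
  have p3 := (poch_pos (x := s + 2 / 3) (by linarith) (n + 1)).ne'
  have hp := poch_three_mul s (n + 1)
  rw [show 3 * (n + 1) = 3 * n + 2 + 1 by ring] at hp
  simp only [Pi.div_apply, Function.comp_apply, gammaSeq_eq, hp]
  have q : (n : ℝ) ^ s * (n : ℝ) ^ (s + 1 / 3) * (n : ℝ) ^ (s + 2 / 3) =
      (n : ℝ) ^ (3 * s) * n := by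
    rw [← Real.rpow_add hn', ← Real.rpow_add hn', ← Real.rpow_add_one hn'.ne']
    congr 1
    ring
  have q' : (3 + 2 / (n : ℝ)) ^ (3 * s) * (n : ℝ) ^ (3 * s) = ((3 * n + 2 : ℕ) : ℝ) ^ (3 * s) := by
    rw [← Real.mul_rpow (by positivity) hn'.le]
    congr 1
    push_cast
    field_simp
  have q3 : (n : ℝ) ^ (3 * s) ≠ 0 := by positivity
  have q4 : (3 + 2 / (n : ℝ)) ^ (3 * s) ≠ 0 := by positivity
  rw [← q']
  have hf : ((3 * n + 2).factorial : ℝ) ≠ 0 := by positivity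
  generalize poch (s + 1 / 3) (n + 1) = v2 at *
  generalize poch (s + 2 / 3) (n + 1) = v3 at *
  generalize (3 + 2 / (n : ℝ)) ^ (3 * s) = w at *
  generalize (n : ℝ) ^ (3 * s) = z at *
  generalize (n : ℝ) ^ s = z1 at *
  generalize (n : ℝ) ^ (s + 1 / 3) = z2 at *
  generalize (n : ℝ) ^ (s + 2 / 3) = z3 at *
  generalize ((3 * n + 2).factorial : ℝ) = g at *
  field_simp
  linear_combination q

theorem Gamma_three_quarters_pow_four :
    Gamma (3 / 4) ^ 4 = √3 / 2 * (Gamma (11 / 12) * Gamma (7 / 12)) ^ 2 := by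
  have h := tendsto_nhds_unique (tendsto_triplication (s := 1 / 4) (by norm_num))
    (tendsto_triplication (s := 1 / 3) (by norm_num))
  norm_num at h
  have r3 := Gamma_mul_Gamma_one_sub (1 / 3)
  have r4 := Gamma_mul_Gamma_one_sub (1 / 4)
  rw [show π * (1 / 3) = π / 3 by ring, sin_pi_div_three] at r3
  rw [show π * (1 / 4) = π / 4 by ring, sin_pi_div_four] at r4
  norm_num at r3 r4
  have hpow : ((3 : ℝ) ^ (3 / 4 : ℝ)) ^ 2 = 3 * √3 := by
    rw [← Real.rpow_natCast, ← Real.rpow_mul (by norm_num), Real.sqrt_eq_rpow,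
      show (3 / 4 : ℝ) * (2 : ℕ) = 1 + 1 / 2 by norm_num, Real.rpow_add (by norm_num),
      Real.rpow_one]
  have hG : 0 < Gamma (3 / 4) := Gamma_pos_of_pos (by norm_num)
  have hG' : 0 < Gamma (1 / 4) := Gamma_pos_of_pos (by norm_num)
  have s3 : √3 ^ 2 = 3 := Real.sq_sqrt (by norm_num)
  have s2 : √2 ^ 2 = 2 := Real.sq_sqrt (by norm_num)
  rw [r3] at h
  generalize (3 : ℝ) ^ (3 / 4 : ℝ) = u at *
  generalize Gamma (3 / 4) = G at *
  generalize Gamma (1 / 4) = g at *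
  generalize Gamma (7 / 12) = m at *
  generalize Gamma (11 / 12) = m' at *
  field_simp at h r4
  have key : u * (m * m') * √3 = 3 * √2 * G ^ 2 := by
    apply mul_left_cancel₀ hG'.ne'
    linear_combination h - 3 * G * r4
  have hsq := congrArg (· ^ 2) key
  simp only [mul_pow, hpow, s3, s2] at hsq
  linear_combination -hsq / 18

/-- Clausen's formula combined with Gauss's summation theorem. -/
theorem F32_half_eq {a b : ℝ} (ha : 0 < a) (hb : 0 < b) (hab : a + b = 1 / 2) :
    F32 (1 / 2) (2 * a) (2 * b) 1 1 1 = π / (Gamma (1 - a) * Gamma (1 - b)) ^ 2 := by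
  have hs := (summable_gaussTerm_zero ha hb hab).norm
  have h := tsum_mul_tsum_eq_tsum_sum_antidiagonal_of_summable_norm hs hs
  simp only [sum_antidiagonal_gaussTerm hab, tsum_gaussTerm_zero ha hb hab] at h
  simp only [F32, one_pow, mul_one]
  rw [← h, ← pow_two, div_pow, Real.sq_sqrt pi_pos.le]

/-- Bailey's cubic transformation evaluation:
`₃F₂(1/2,1/2,1/2;1,1;1) = (2/√3) · ₃F₂(1/2,1/6,5/6;1,1;1)`. -/
theorem F32_cubic_relation :
    F32 (1/2) (1/2) (1/2) 1 1 1 = 2 / Real.sqrt 3 * F32 (1/2) (1/6) (5/6) 1 1 1 := by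
  have h1 := F32_half_eq (a := 1 / 4) (b := 1 / 4) (by norm_num) (by norm_num) (by norm_num)
  have h2 := F32_half_eq (a := 1 / 12) (b := 5 / 12) (by norm_num) (by norm_num) (by norm_num)
  norm_num at h1 h2 ⊢
  rw [h1, h2, ← pow_two, ← pow_mul, Gamma_three_quarters_pow_four]
  have hG : Gamma (11 / 12) ≠ 0 := (Gamma_pos_of_pos (by norm_num)).ne'
  have hG' : Gamma (7 / 12) ≠ 0 := (Gamma_pos_of_pos (by norm_num)).ne'
  field_simp
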